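/- arXiv:2206.01382 — 3 statements merged into one kernel-verified Lean document; each statement's English description precedes it below -/
import Mathlib

section
/- Let D > 1 be a real number, let c > 1 and r > 0 with c·r < 2, and let y, q ∈ ℝ^d be unit vectors with ‖y - q‖ ≥ c·r. Set t = (1 - r²/2)·√(2·ln D) and γ = (c·r·(1 - 1/c²)/√(4 - c²r²))·√(2·ln D). Then the Gaussian measure gaussianReal ((⟪y, q⟫)·√(2·ln D)) (1 - ⟪y, q⟫²) assigns measure at most (1/(γ·√(2π)))·exp(-γ²/2) to the set {z : z ≥ t}. (This is property (ii) of Theorem 1: a far away point y in the bucket of q survives the filter with probability at most q₂ = (1/(γ√(2π)))·e^{-γ²/2}.) -/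
open ProbabilityTheory Real
open scoped RealInnerProductSpace

/-- The Mills ratio upper bound for the tail of a Gaussian law, `g` standard deviations above its
mean. -/
theorem gaussianReal_upper_tail_le (m : ℝ) {v : NNReal} (hv : v ≠ 0) {g : ℝ} (hg : 0 < g) :
    gaussianReal m v (Set.Ici (m + g * √v)) ≤
      ENNReal.ofReal (1 / (g * √(2 * π)) * exp (-g ^ 2 / 2)) := by
  have hv0 : (0 : ℝ) < v := NNReal.coe_pos.2 (pos_iff_ne_zero.2 hv)
  have hσ : 0 < √(v : ℝ) := Real.sqrt_pos.2 hv0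
  have hσ2 : √(v : ℝ) ^ 2 = v := Real.sq_sqrt hv0.le
  set σ := √(v : ℝ) with hσdef
  have hderiv (x : ℝ) : HasDerivAt (fun x ↦ -(σ / g) * gaussianPDFReal m v x)
      ((x - m) / (g * σ) * gaussianPDFReal m v x) x := by
    have h1 : HasDerivAt (fun x : ℝ ↦ -(x - m) ^ 2 / (2 * v)) (-(x - m) / v) x := by
      convert! (((hasDerivAt_id x).sub_const m).pow 2).neg.div_const (2 * (v : ℝ)) using 1
      simp
      field_simp
      ring
    convert! (h1.exp.const_mul (√(2 * π * v))⁻¹).const_mul (-(σ / g)) using 1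
    rw [gaussianPDFReal, ← hσ2]
    field_simp
  have hlim : Filter.Tendsto (fun x ↦ -(σ / g) * gaussianPDFReal m v x) Filter.atTop (nhds 0) := by
    have h1 : Filter.Tendsto (fun x : ℝ ↦ (x - m) ^ 2 / (2 * v)) Filter.atTop Filter.atTop :=
      ((Filter.tendsto_pow_atTop two_ne_zero).comp
        (Filter.tendsto_atTop_add_const_right _ (-m) Filter.tendsto_id)).atTop_div_const
          (by positivity)
    have h2 := ((Real.tendsto_exp_neg_atTop_nhds_zero.comp h1).const_mul
      (√(2 * π * v))⁻¹).const_mul (-(σ / g))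
    simpa [gaussianPDFReal_def, Function.comp_def, neg_div] using h2
  have hgt (x : ℝ) (hx : x ∈ Set.Ioi (m + g * σ)) : 1 ≤ (x - m) / (g * σ) := by
    rw [one_le_div (by positivity)]
    linarith [Set.mem_Ioi.1 hx]
  have hnonneg (x : ℝ) (hx : x ∈ Set.Ioi (m + g * σ)) :
      0 ≤ (x - m) / (g * σ) * gaussianPDFReal m v x :=
    mul_nonneg (zero_le_one.trans (hgt x hx)) (gaussianPDFReal_nonneg m v x)
  rw [gaussianReal_apply_eq_integral m hv, MeasureTheory.integral_Ici_eq_integral_Ioi]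
  apply ENNReal.ofReal_le_ofReal
  calc ∫ x in Set.Ioi (m + g * σ), gaussianPDFReal m v x
      ≤ ∫ x in Set.Ioi (m + g * σ), (x - m) / (g * σ) * gaussianPDFReal m v x :=
        MeasureTheory.setIntegral_mono_on (integrable_gaussianPDFReal m v).integrableOn
          (MeasureTheory.integrableOn_Ioi_deriv_of_nonneg' (fun x _ ↦ hderiv x) hnonneg hlim)
          measurableSet_Ioi
          fun x hx ↦ le_mul_of_one_le_left (gaussianPDFReal_nonneg m v x) (hgt x hx)
    _ = 0 - -(σ / g) * gaussianPDFReal m v (m + g * σ) :=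
        MeasureTheory.integral_Ioi_of_hasDerivAt_of_nonneg' (fun x _ ↦ hderiv x) hnonneg hlim
    _ = 1 / (g * √(2 * π)) * exp (-g ^ 2 / 2) := by
        rw [gaussianPDFReal, Real.sqrt_mul (by positivity), ← hσdef, ← hσ2]
        have : -(m + g * σ - m) ^ 2 / (2 * σ ^ 2) = -g ^ 2 / 2 := by
          field_simp
          ring
        rw [this]
        field_simp
        ring

/-- The normalized gap `(s - r² / s) / √(4 - s²)` is monotone in `s`; the denominator at the larger
point `s` is cleared, so that `2 ≤ s` is allowed. -/
theorem div_sqrt_four_sub_sq_mul_le {r a s : ℝ} (ha : 0 < a) (has : a ≤ s) (hra : r ^ 2 ≤ a ^ 2)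
    (ha2 : a < 2) :
    (a - r ^ 2 / a) / √(4 - a ^ 2) * √(4 - s ^ 2) ≤ s - r ^ 2 / s := by
  have hs : 0 < s := ha.trans_le has
  have hpos : 0 < √(4 - a ^ 2) := Real.sqrt_pos.2 (by nlinarith)
  have hsqrt : √(4 - s ^ 2) ≤ √(4 - a ^ 2) := Real.sqrt_le_sqrt (by nlinarith)
  have hgap : 0 ≤ a - r ^ 2 / a := by
    rw [sub_nonneg, div_le_iff₀ ha]
    nlinarith
  have hdiv : r ^ 2 / s ≤ r ^ 2 / a := by gcongr
  calc (a - r ^ 2 / a) / √(4 - a ^ 2) * √(4 - s ^ 2)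
      ≤ (a - r ^ 2 / a) / √(4 - a ^ 2) * √(4 - a ^ 2) := by gcongr
    _ = a - r ^ 2 / a := div_mul_cancel₀ _ hpos.ne'
    _ ≤ s - r ^ 2 / s := by linarith

/-- Theorem 1(ii) of Falconn++: a far away point `y` (with `‖y - q‖ ≥ c·r`) in the bucket of `q`
survives the filter with probability at most `q₂ = (1/(γ√(2π)))·e^{-γ²/2}`, where
`γ = (cr(1 - 1/c²)/√(4 - c²r²))·√(2 ln D)`, the projection value of `y` is modeled by the
Gaussian law with mean `⟪y,q⟫·√(2 ln D)` and variance `1 - ⟪y,q⟫²`, and the filtering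
threshold is `t = (1 - r²/2)·√(2 ln D)`. -/
theorem falconnpp_far_point_filtered
    (d : ℕ) (D c r : ℝ) (hD : 1 < D) (hc : 1 < c) (hr : 0 < r) (hcr : c * r < 2)
    (y q : EuclideanSpace ℝ (Fin d)) (hy : ‖y‖ = 1) (hq : ‖q‖ = 1)
    (hfar : c * r ≤ ‖y - q‖) :
    gaussianReal (⟪y, q⟫ * Real.sqrt (2 * Real.log D))
        (Real.toNNReal (1 - ⟪y, q⟫ ^ 2))
        {z : ℝ | (1 - r ^ 2 / 2) * Real.sqrt (2 * Real.log D) ≤ z} ≤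
      ENNReal.ofReal
        (1 / ((c * r * (1 - 1 / c ^ 2) / Real.sqrt (4 - c ^ 2 * r ^ 2) * Real.sqrt (2 * Real.log D))
            * Real.sqrt (2 * Real.pi)) *
          Real.exp (-(c * r * (1 - 1 / c ^ 2) / Real.sqrt (4 - c ^ 2 * r ^ 2)
            * Real.sqrt (2 * Real.log D)) ^ 2 / 2)) := by
  have hL : 0 < √(2 * log D) := Real.sqrt_pos.2 (by linarith [Real.log_pos hD])
  have hc0 : 0 < c := by linarith
  have ha : 0 < c * r := by positivity
  have hrlt : r < c * r := by nlinarith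
  set L := √(2 * log D)
  set s := ‖y - q‖
  have hs : 0 < s := ha.trans_le hfar
  have hs2 : s ≤ 2 := (norm_sub_le y q).trans (by rw [hy, hq]; norm_num)
  have hinner : ⟪y, q⟫ = 1 - s ^ 2 / 2 := by
    have h := norm_sub_sq_real y q
    rw [hy, hq] at h
    linarith
  change gaussianReal _ _ (Set.Ici ((1 - r ^ 2 / 2) * L)) ≤ _
  rw [hinner]
  have hvar : 1 - (1 - s ^ 2 / 2) ^ 2 = (s / 2) ^ 2 * (4 - s ^ 2) := by ring
  rcases hs2.eq_or_lt with h2 | h2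
  · have hvar0 : 1 - (1 - s ^ 2 / 2) ^ 2 = 0 := by rw [h2]; norm_num
    rw [hvar0, Real.toNNReal_zero, gaussianReal_zero_var,
      MeasureTheory.Measure.dirac_apply' _ measurableSet_Ici, Set.indicator_of_notMem]
    · exact zero_le
    · rw [Set.mem_Ici, not_le, h2]
      exact mul_lt_mul_of_pos_right (by nlinarith) hL
  · have h4 : 0 < 4 - s ^ 2 := by nlinarith
    have hvpos : 0 < 1 - (1 - s ^ 2 / 2) ^ 2 := by rw [hvar]; positivity
    have hsd : √(Real.toNNReal (1 - (1 - s ^ 2 / 2) ^ 2) : ℝ) = s / 2 * √(4 - s ^ 2) := by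
      rw [Real.coe_toNNReal _ hvpos.le, hvar, Real.sqrt_mul (sq_nonneg _),
        Real.sqrt_sq (by positivity)]
    have hden : 0 < √(4 - c ^ 2 * r ^ 2) := Real.sqrt_pos.2 (by nlinarith)
    have hcinv : 0 < 1 - 1 / c ^ 2 := by
      rw [sub_pos, div_lt_one (by positivity)]
      nlinarith
    refine le_trans (MeasureTheory.measure_mono ?_)
      (gaussianReal_upper_tail_le _ (Real.toNNReal_pos.2 hvpos).ne' (by positivity))
    intro z (hz : (1 - r ^ 2 / 2) * L ≤ z)
    refine le_trans ?_ hz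
    rw [hsd]
    have hmono := div_sqrt_four_sub_sq_mul_le ha hfar (pow_le_pow_left₀ hr.le hrlt.le 2) hcr
    have hnum : c * r - r ^ 2 / (c * r) = c * r * (1 - 1 / c ^ 2) := by field_simp
    rw [hnum, mul_pow] at hmono
    have hscaled := mul_le_mul_of_nonneg_left hmono (by positivity : 0 ≤ s / 2 * L)
    have hright : s / 2 * L * (s - r ^ 2 / s) = (s ^ 2 - r ^ 2) / 2 * L := by field_simp
    rw [hright] at hscaled
    linarith
end

section
/- Fix r with 0 < r < 2. The function s ↦ (s² - r²)/(s·√(4 - s²)) is strictly increasing on the interval (r, 2): for all s₁, s₂ with r < s₁ < s₂ < 2, one has (s₁² - r²)/(s₁·√(4 - s₁²)) < (s₂² - r²)/(s₂·√(4 - s₂²)). -/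
open Real

/-- For fixed `0 < r < 2`, the standardized-gap function `s ↦ (s² - r²)/(s·√(4 - s²))` is
strictly increasing on the interval `(r, 2)`: farther points have a larger standardized gap
and hence a higher probability of being discarded by the filter. -/
theorem falconnpp_gap_strictMono (r : ℝ) (hr : 0 < r) (hr2 : r < 2)
    (s₁ s₂ : ℝ) (h1 : r < s₁) (h12 : s₁ < s₂) (h2 : s₂ < 2) :
    (s₁ ^ 2 - r ^ 2) / (s₁ * Real.sqrt (4 - s₁ ^ 2)) <
      (s₂ ^ 2 - r ^ 2) / (s₂ * Real.sqrt (4 - s₂ ^ 2)) := by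
  have hs₁ : 0 < s₁ := hr.trans h1
  have hs₂ : 0 < s₂ := hs₁.trans h12
  have hnum : (s₁ ^ 2 - r ^ 2) / s₁ < (s₂ ^ 2 - r ^ 2) / s₂ := by
    rw [div_lt_div_iff₀ hs₁ hs₂]
    nlinarith [mul_pos (sub_pos.2 h12) (add_pos (mul_pos hs₁ hs₂) (pow_pos hr 2))]
  have hnum_nonneg : 0 ≤ (s₂ ^ 2 - r ^ 2) / s₂ :=
    div_nonneg (by nlinarith) hs₂.le
  have hsqrt_pos : 0 < Real.sqrt (4 - s₂ ^ 2) := Real.sqrt_pos.2 (by nlinarith)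
  have hsqrt_le : Real.sqrt (4 - s₂ ^ 2) ≤ Real.sqrt (4 - s₁ ^ 2) :=
    Real.sqrt_le_sqrt (by nlinarith)
  rw [← div_div, ← div_div]
  exact div_lt_div₀ hnum hsqrt_le hnum_nonneg hsqrt_pos
end

section
/- Let c > 1 and r > 0 with c·r < 2. Set A = c·r·(1 - 1/c²)/√(4 - c²r²), γ(D) = A·√(2·ln D), and q₂(D) = (1/(γ(D)·√(2π)))·exp(-γ(D)²/2). Then, as the real number D tends to infinity, the quantity (ln 2 + (ln D)/(4/r² - 1)) / (ln(1/q₂(D)) + (ln D)/(4/(c²r²) - 1)) converges to (1/(1 + (1 - 1/c²)²)) · ((4/(c²r²) - 1)/(4/r² - 1)). -/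
open Real Filter

/-- The logarithm of the reciprocal of the Gaussian tail density at `A * √(2 * L)`. -/
theorem log_one_div_gaussian_tail {A L : ℝ} (hA : 0 < A) (hL : 0 < L) :
    Real.log (1 / (1 / (A * Real.sqrt (2 * L) * Real.sqrt (2 * Real.pi)) *
        Real.exp (-(A * Real.sqrt (2 * L)) ^ 2 / 2))) =
      Real.log (A * Real.sqrt 2 * Real.sqrt (2 * Real.pi)) + Real.log L / 2 + A ^ 2 * L := by
  have hsqrt : 0 < Real.sqrt L := Real.sqrt_pos.2 hL
  have hpi : 0 < Real.sqrt (2 * Real.pi) := Real.sqrt_pos.2 (by positivity)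
  have hsq : (A * Real.sqrt (2 * L)) ^ 2 = 2 * (A ^ 2 * L) := by
    rw [mul_pow, Real.sq_sqrt (by positivity)]
    ring
  have hfac : A * Real.sqrt (2 * L) * Real.sqrt (2 * Real.pi) =
      A * Real.sqrt 2 * Real.sqrt (2 * Real.pi) * Real.sqrt L := by
    rw [Real.sqrt_mul (by norm_num)]
    ring
  rw [hsq, hfac, one_div, Real.log_inv, Real.log_mul (by positivity) (Real.exp_ne_zero _),
    Real.log_exp, one_div, Real.log_inv, Real.log_mul (by positivity) hsqrt.ne',
    Real.log_sqrt hL.le]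
  ring

/-- A quotient of functions that are affine in `x`, up to a logarithm in the denominator, tends
to the quotient of the slopes. -/
theorem tendsto_affine_div_affine_add_log (a b u v : ℝ) (hv : v ≠ 0) :
    Tendsto (fun x : ℝ => (a + x * u) / (b + Real.log x / 2 + x * v)) atTop (nhds (u / v)) := by
  have hconst (k : ℝ) : Tendsto (fun x : ℝ => k / x) atTop (nhds 0) :=
    tendsto_const_nhds.div_atTop tendsto_id
  have hlog : Tendsto (fun x : ℝ => Real.log x / x) atTop (nhds 0) :=
    Real.isLittleO_log_id_atTop.tendsto_div_nhds_zero
  have hnum : Tendsto (fun x : ℝ => a / x + u) atTop (nhds u) := by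
    simpa using (hconst a).add_const u
  have hden : Tendsto (fun x : ℝ => b / x + Real.log x / x / 2 + v) atTop (nhds v) := by
    simpa using ((hconst b).add (hlog.div_const 2)).add_const v
  refine (hnum.div hden hv).congr' ?_
  filter_upwards [eventually_gt_atTop 0] with x hx
  rw [Pi.div_apply, ← mul_div_mul_left (a / x + u) _ hx.ne']
  congr 1 <;> field_simp

/-- Asymptotic combined exponent of Falconn++: with `A = cr(1-1/c²)/√(4 - c²r²)`,
`γ(D) = A√(2 ln D)` and `q₂(D) = (1/(γ(D)√(2π)))·e^{-γ(D)²/2}`, the quantity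
`(ln 2 + (ln D)/(4/r² - 1)) / (ln(1/q₂(D)) + (ln D)/(4/(c²r²) - 1))` converges, as
`D → ∞`, to `ρ' = (1/(1 + (1 - 1/c²)²)) · ((4/(c²r²) - 1)/(4/r² - 1))`. -/
theorem falconnpp_exponent_limit (c r : ℝ) (hc : 1 < c) (hr : 0 < r) (hcr : c * r < 2) :
    Tendsto (fun D : ℝ =>
        (Real.log 2 + Real.log D / (4 / r ^ 2 - 1)) /
          (Real.log (1 /
              (1 / (c * r * (1 - 1 / c ^ 2) / Real.sqrt (4 - c ^ 2 * r ^ 2)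
                    * Real.sqrt (2 * Real.log D) * Real.sqrt (2 * Real.pi)) *
                Real.exp (-(c * r * (1 - 1 / c ^ 2) / Real.sqrt (4 - c ^ 2 * r ^ 2)
                    * Real.sqrt (2 * Real.log D)) ^ 2 / 2)))
            + Real.log D / (4 / (c ^ 2 * r ^ 2) - 1)))
      atTop
      (nhds ((1 / (1 + (1 - 1 / c ^ 2) ^ 2)) *
        ((4 / (c ^ 2 * r ^ 2) - 1) / (4 / r ^ 2 - 1)))) := by
  have hc0 : 0 < c := one_pos.trans hc
  have hcr0 : 0 < c * r := mul_pos hc0 hr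
  have hcr4 : 0 < 4 - c ^ 2 * r ^ 2 := by nlinarith
  have hc2 : 0 < 1 - 1 / c ^ 2 := by
    rw [sub_pos, div_lt_one (by positivity)]
    nlinarith
  have hs : 4 / (c ^ 2 * r ^ 2) - 1 = (4 - c ^ 2 * r ^ 2) / (c ^ 2 * r ^ 2) := by
    field_simp
  have hs0 : 0 < 4 / (c ^ 2 * r ^ 2) - 1 := by
    rw [hs]
    positivity
  have hA : 0 < c * r * (1 - 1 / c ^ 2) / Real.sqrt (4 - c ^ 2 * r ^ 2) :=
    div_pos (mul_pos hcr0 hc2) (Real.sqrt_pos.2 hcr4)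
  have hA2 : (c * r * (1 - 1 / c ^ 2) / Real.sqrt (4 - c ^ 2 * r ^ 2)) ^ 2 =
      (1 - 1 / c ^ 2) ^ 2 / (4 / (c ^ 2 * r ^ 2) - 1) := by
    rw [div_pow, Real.sq_sqrt hcr4.le, hs, div_div_eq_mul_div]
    ring
  generalize c * r * (1 - 1 / c ^ 2) / Real.sqrt (4 - c ^ 2 * r ^ 2) = A at hA hA2 ⊢
  generalize 4 / (c ^ 2 * r ^ 2) - 1 = s at hs0 hA2 ⊢
  generalize 4 / r ^ 2 - 1 = p
  have hslope : 0 < A ^ 2 + 1 / s := by positivity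
  have hlim := (tendsto_affine_div_affine_add_log (Real.log 2)
    (Real.log (A * Real.sqrt 2 * Real.sqrt (2 * Real.pi))) (1 / p) (A ^ 2 + 1 / s)
    hslope.ne').comp Real.tendsto_log_atTop
  have hval : 1 / p / (A ^ 2 + 1 / s) = 1 / (1 + (1 - 1 / c ^ 2) ^ 2) * (s / p) := by
    rw [hA2, ← add_div, div_div_eq_mul_div, add_comm]
    ring
  rw [hval] at hlim
  refine hlim.congr' ?_
  filter_upwards [eventually_gt_atTop 1] with D hD
  rw [log_one_div_gaussian_tail hA (Real.log_pos hD), Function.comp_apply]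
  congr 1 <;> ring
end
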